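/- Let S ⊆ ℝⁿ be an unbounded set, and suppose there exist a bounded set K ⊆ ℝⁿ and a nonzero polynomial p ∈ ℝ[x₁,…,xₙ] such that S ⊆ K ∪ {x ∈ ℝⁿ : p(x) = 0}. Then the ring B(S) of polynomials bounded on S is not Noetherian. -/

import Mathlib

/-- The `ℝ`-subalgebra `B(S)` of `ℝ[x₁,…,xₙ]` consisting of the polynomials whose
image on `S ⊆ ℝⁿ` is a bounded subset of `ℝ`. -/
noncomputable def polyBdd (n : ℕ) (S : Set (Fin n → ℝ)) :
    Subalgebra ℝ (MvPolynomial (Fin n) ℝ) where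
  carrier := {f | Bornology.IsBounded ((fun x => MvPolynomial.eval x f) '' S)}
  add_mem' := by
    intro a b ha hb
    rw [Set.mem_setOf_eq, isBounded_iff_forall_norm_le] at *
    obtain ⟨Ca, hCa⟩ := ha
    obtain ⟨Cb, hCb⟩ := hb
    refine ⟨Ca + Cb, ?_⟩
    rintro _ ⟨x, hx, rfl⟩
    simp only [map_add]
    calc ‖MvPolynomial.eval x a + MvPolynomial.eval x b‖
        ≤ ‖MvPolynomial.eval x a‖ + ‖MvPolynomial.eval x b‖ := norm_add_le _ _
      _ ≤ Ca + Cb := add_le_add (hCa _ ⟨x, hx, rfl⟩) (hCb _ ⟨x, hx, rfl⟩)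
  mul_mem' := by
    intro a b ha hb
    rw [Set.mem_setOf_eq, isBounded_iff_forall_norm_le] at *
    obtain ⟨Ca, hCa⟩ := ha
    obtain ⟨Cb, hCb⟩ := hb
    refine ⟨max Ca 0 * max Cb 0, ?_⟩
    rintro _ ⟨x, hx, rfl⟩
    simp only [map_mul, norm_mul]
    exact mul_le_mul (le_max_of_le_left (hCa _ ⟨x, hx, rfl⟩))
      (le_max_of_le_left (hCb _ ⟨x, hx, rfl⟩)) (norm_nonneg _) (le_max_right _ _)
  zero_mem' := by
    rw [Set.mem_setOf_eq, isBounded_iff_forall_norm_le]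
    exact ⟨0, by rintro _ ⟨x, hx, rfl⟩; simp⟩
  one_mem' := by
    rw [Set.mem_setOf_eq, isBounded_iff_forall_norm_le]
    exact ⟨1, by rintro _ ⟨x, hx, rfl⟩; simp⟩
  algebraMap_mem' := by
    intro r
    rw [Set.mem_setOf_eq, isBounded_iff_forall_norm_le]
    refine ⟨‖r‖, ?_⟩
    rintro _ ⟨x, hx, rfl⟩
    simp [MvPolynomial.algebraMap_eq]

theorem mem_polyBdd_iff {n : ℕ} {S : Set (Fin n → ℝ)} {f : MvPolynomial (Fin n) ℝ} :
    f ∈ polyBdd n S ↔ Bornology.IsBounded ((fun x => MvPolynomial.eval x f) '' S) :=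
  Iff.rfl

theorem isBounded_image_eval {n : ℕ} {K : Set (Fin n → ℝ)} (hK : Bornology.IsBounded K)
    (f : MvPolynomial (Fin n) ℝ) :
    Bornology.IsBounded ((fun x => MvPolynomial.eval x f) '' K) :=
  (hK.isCompact_closure.image (MvPolynomial.continuous_eval f)).isBounded.subset
    (Set.image_mono subset_closure)

/-- A polynomial which is integral over `B(S)` is bounded on `S`. -/
theorem mem_polyBdd_of_isIntegral {n : ℕ} {S : Set (Fin n → ℝ)} {f : MvPolynomial (Fin n) ℝ}
    (hf : IsIntegral (polyBdd n S) f) : f ∈ polyBdd n S := by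
  obtain ⟨q, hq, hqf⟩ := hf
  have hbdd (i : ℕ) : ∃ C : NNReal, ∀ x ∈ S,
      ‖MvPolynomial.eval x (q.coeff i : MvPolynomial (Fin n) ℝ)‖₊ ≤ C := by
    obtain ⟨C, hC⟩ := isBounded_iff_forall_norm_le.mp (mem_polyBdd_iff.mp (q.coeff i).2)
    refine ⟨C.toNNReal, fun x hx => ?_⟩
    rw [← norm_toNNReal]
    exact Real.toNNReal_le_toNNReal (hC _ ⟨x, hx, rfl⟩)
  choose C hC using hbdd
  rw [mem_polyBdd_iff, isBounded_iff_forall_norm_le]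
  refine ⟨((Finset.range q.natDegree).sup C + 1 : NNReal), ?_⟩
  rintro _ ⟨x, hx, rfl⟩
  let φ : polyBdd n S →+* ℝ := (MvPolynomial.eval x).comp (polyBdd n S).val.toRingHom
  have hmonic : (q.map φ).Monic := hq.map φ
  have hroot : (q.map φ).IsRoot (MvPolynomial.eval x f) := by
    have h := congrArg (MvPolynomial.eval x) hqf
    rw [Polynomial.hom_eval₂, map_zero] at h
    rw [Polynomial.IsRoot, Polynomial.eval_map]
    exact h
  have hlt := hroot.norm_lt_cauchyBound hmonic.ne_zero
  refine NNReal.coe_le_coe.mpr (hlt.le.trans ?_)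
  rw [Polynomial.cauchyBound, hmonic.leadingCoeff, nnnorm_one, div_one, hq.natDegree_map]
  gcongr
  rw [Polynomial.coeff_map]
  exact hC _ x hx

theorem mul_mem_polyBdd {n : ℕ} {S K : Set (Fin n → ℝ)} (hK : Bornology.IsBounded K)
    {p : MvPolynomial (Fin n) ℝ} (hSK : S ⊆ K ∪ {x | MvPolynomial.eval x p = 0})
    (f : MvPolynomial (Fin n) ℝ) : p * f ∈ polyBdd n S := by
  rw [mem_polyBdd_iff]
  refine ((isBounded_image_eval hK (p * f)).union
    (Bornology.isBounded_singleton (x := (0 : ℝ)))).subset ?_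
  rintro _ ⟨x, hx, rfl⟩
  obtain hxK | hxp := hSK hx
  · exact Or.inl ⟨x, hxK, rfl⟩
  · exact Or.inr (by simp [show MvPolynomial.eval x p = 0 from hxp])

/-- If `S ⊆ ℝⁿ` is unbounded but contained in the union of a bounded
set `K` and the zero set of a nonzero polynomial `p`, then the ring `B(S)` of
polynomials bounded on `S` is not Noetherian. -/
theorem not_noetherian_of_not_zariski_dense_at_infinity
    (n : ℕ) (S : Set (Fin n → ℝ)) (hS : ¬ Bornology.IsBounded S)
    (K : Set (Fin n → ℝ)) (hK : Bornology.IsBounded K)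
    (p : MvPolynomial (Fin n) ℝ) (hp : p ≠ 0)
    (hSK : S ⊆ K ∪ {x | MvPolynomial.eval x p = 0}) :
    ¬ IsNoetherianRing (polyBdd n S) := by
  intro hN
  let mulP : MvPolynomial (Fin n) ℝ →ₗ[polyBdd n S] polyBdd n S :=
    { toFun f := ⟨p * f, mul_mem_polyBdd hK hSK f⟩
      map_add' f g := Subtype.ext (mul_add p f g)
      map_smul' b f := Subtype.ext (mul_left_comm p (b : MvPolynomial (Fin n) ℝ) f) }
  have hinj : Function.Injective mulP := fun f g hfg =>
    mul_left_cancel₀ hp (congrArg Subtype.val hfg)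
  have hfin : IsNoetherian (polyBdd n S) (MvPolynomial (Fin n) ℝ) :=
    isNoetherian_of_injective mulP hinj
  refine hS (Bornology.forall_isBounded_image_eval_iff.mp fun i => ?_)
  have hX : MvPolynomial.X i ∈ polyBdd n S :=
    mem_polyBdd_of_isIntegral (Algebra.IsIntegral.isIntegral _)
  simpa only [mem_polyBdd_iff, MvPolynomial.eval_X] using hX
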